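/- Let G = PSL(2,ℤ) with r, u, S = {r, u, u⁻¹} as above, and let T : G → {0,…,5} be the type function defined by: T(g) = 0 if 𝐒₂*(g) = ∅; T(g) = 1 if 𝐒₂*(g) = {r}; T(g) = 2 if 𝐒₂*(g) = {ar} for a = u or u⁻¹; T(g) = 3 if 𝐒₂*(g) = {a} or {aa}; T(g) = 4 if 𝐒₂*(g) = {ra} or {ra, aa}; T(g) = 5 if 𝐒₂*(g) = {ra, ār}. Then T is compatible with S, and moreover for every g ∈ G the multiset {T(g·s) : s ∈ S⁺(g)} equals: {1,3,3} if T(g)=0; {4,4} if T(g)=1; {4,5} if T(g)=2; {2,3} if T(g)=3; {3,5} if T(g)=4; {4} if T(g)=5. -/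

import Mathlib

namespace PSL2Z

abbrev SL2Z : Type := Matrix.SpecialLinearGroup (Fin 2) ℤ

/-- `PSL(2,ℤ)`: the quotient of `SL(2,ℤ)` by its center `{±I}`. -/
abbrev G : Type := SL2Z ⧸ Subgroup.center SL2Z

/-- The image in `PSL(2,ℤ)` of the matrix `[[0,1],[-1,0]]`. -/
def r : G := QuotientGroup.mk (⟨!![0, 1; -1, 0], by norm_num [Matrix.det_fin_two_of]⟩ : SL2Z)

/-- The image in `PSL(2,ℤ)` of the matrix `[[1,1],[0,1]]`. -/
def u : G := QuotientGroup.mk (⟨!![1, 1; 0, 1], by norm_num [Matrix.det_fin_two_of]⟩ : SL2Z)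

/-- The symmetric generating set `S = {r, u, u⁻¹}`. -/
def S : Set G := {r, u, u⁻¹}

/-- A word in `S`: a finite list of elements of `S`. -/
def IsWord (w : List G) : Prop := ∀ x ∈ w, x ∈ S

/-- The word norm `|g|`: the least length of a word in `S` representing `g`. -/
noncomputable def wordNorm (g : G) : ℕ :=
  sInf {n | ∃ w : List G, IsWord w ∧ w.prod = g ∧ w.length = n}

/-- A geodesic for `g`: a word in `S` representing `g` of length `|g|`. -/
def IsGeodesic (g : G) (w : List G) : Prop :=
  IsWord w ∧ w.prod = g ∧ w.length = wordNorm g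

/-- `𝐒ₙ(g)`: the set of suffixes of length `n` of geodesics for `g`. -/
def Suf (n : ℕ) (g : G) : Set (List G) :=
  {v | v.length = n ∧ ∃ w : List G, IsGeodesic g w ∧ v <:+ w}

open Classical in
/-- `𝐒₂*(g)`: `𝐒₂(g)` if nonempty, otherwise `𝐒₁(g)` (which is `∅` exactly when `g = 1`). -/
noncomputable def Suf2Star (g : G) : Set (List G) :=
  if (Suf 2 g).Nonempty then Suf 2 g else Suf 1 g

/-- `S⁺(g) = {s ∈ S : |g·s| = |g| + 1}`. -/
def Splus (g : G) : Set G := {s ∈ S | wordNorm (g * s) = wordNorm g + 1}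

open Classical in
/-- `S⁺(g)` as a finset. -/
noncomputable def SplusF (g : G) : Finset G :=
  ({r, u, u⁻¹} : Finset G).filter fun s => wordNorm (g * s) = wordNorm g + 1

open Classical in
/-- The type function `T : G → {0,…,5}` determined by `𝐒₂*`. -/
noncomputable def T (g : G) : Fin 6 :=
  if Suf2Star g = (∅ : Set (List G)) then 0
  else if Suf2Star g = {[r]} then 1
  else if ∃ a ∈ ({u, u⁻¹} : Set G), Suf2Star g = {[a, r]} then 2
  else if ∃ a ∈ ({u, u⁻¹} : Set G),
      Suf2Star g = {[a]} ∨ Suf2Star g = {[a, a]} then 3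
  else if ∃ a ∈ ({u, u⁻¹} : Set G),
      Suf2Star g = {[r, a]} ∨ Suf2Star g = {[r, a], [a, a]} then 4
  else 5

/-- The multiset of types of successors of an element of each type. -/
def typeSucc : Fin 6 → Multiset (Fin 6) :=
  ![{1, 3, 3}, {4, 4}, {4, 5}, {2, 3}, {3, 5}, {4}]

/-- Codes for the letters of `S`: `none` stands for `r`, `some true` for `u` and `some false`
for `u⁻¹`. -/
abbrev Letter : Type := Option Bool

/-- The element of `S` with a given code. -/
def Letter.toG : Letter → G
  | none => r
  | some true => u
  | some false => u⁻¹

/-- The code of the inverse letter. -/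
def Letter.inv : Letter → Letter
  | none => none
  | some c => some (!c)

/-- Normal forms for the elements of `PSL(2,ℤ)`: besides `1` and `r`, words in which `r` separates
maximal runs of `u` and `u⁻¹` of alternating signs. In `word e a l d`, the booleans `e` and `d` say
whether there is a leading and a trailing `r`, and `a :: l` lists the signs of the letters other
than `r`, from right to left. -/
inductive NormalForm : Type
  | one : NormalForm
  | refl : NormalForm
  | word (e a : Bool) (l : List Bool) (d : Bool) : NormalForm

namespace NormalForm

/-- The element `r` or `1`, according to a flag. -/
def flag (e : Bool) : G := if e then r else 1

/-- The value of a normal form without trailing `r`. -/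
def evalCore (e a : Bool) : List Bool → G
  | [] => flag e * Letter.toG (some a)
  | b :: l => evalCore e b l * flag (a != b) * Letter.toG (some a)

/-- The element of `PSL(2,ℤ)` represented by a normal form. -/
def eval : NormalForm → G
  | one => 1
  | refl => r
  | word e a l d => evalCore e a l * flag d

/-- The length of a normal form without leading and trailing `r`. -/
def lenCore (a : Bool) : List Bool → ℕ
  | [] => 1
  | b :: l => lenCore b l + (if a = b then 1 else 2)

/-- The length of a normal form as a word. -/
def len : NormalForm → ℕ
  | one => 0
  | refl => 1
  | word e a l d => lenCore a l + e.toNat + d.toNat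

/-- Remove the last letter of a normal form without trailing `r`. -/
def pop (e a : Bool) : List Bool → NormalForm
  | [] => if e then refl else one
  | b :: l => word e b l (a != b)

/-- Flip the sign of the last letter other than `r`. -/
def flip (e a : Bool) : List Bool → NormalForm
  | [] => word (!e) (!a) [] true
  | b :: l => word e (!a) (b :: l) true

/-- Right multiplication of normal forms by a letter. -/
def act : NormalForm → Letter → NormalForm
  | one, none => refl
  | refl, none => one
  | word e a l d, none => word e a l (!d)
  | one, some c => word false c [] false
  | refl, some c => word true c [] false
  | word e a l false, some c => if c = a then word e c (a :: l) false else pop e a l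
  | word e a l true, some c => if c = a then flip e a l else word e c (a :: l) false

/-- Whether the last letter other than `r` is preceded by `r`. -/
def afterR (e a : Bool) : List Bool → Bool
  | [] => e
  | b :: _ => a != b

/-- The possible last letters of the geodesics for a normal form. -/
def lastLetters : NormalForm → Finset Letter
  | one => ∅
  | refl => {none}
  | word _ a _ false => {some a}
  | word e a l true => if afterR e a l then {none, some (!a)} else {none}

/-- The suffixes of length two of the geodesics for a normal form. -/
def suffixes₂ (x : NormalForm) : Finset (List Letter) :=
  x.lastLetters.biUnion fun t => (x.act t.inv).lastLetters.image fun s => [s, t]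

/-- The analogue of `Suf2Star` for normal forms. -/
def suffixes (x : NormalForm) : Finset (List Letter) :=
  if x.suffixes₂ = ∅ then x.lastLetters.image fun t => [t] else x.suffixes₂

/-- The type of a normal form. -/
def type : NormalForm → Fin 6
  | one => 0
  | refl => 1
  | word e a l true => if afterR e a l then 5 else 2
  | word e a l false => if afterR e a l then 4 else 3

end NormalForm

open NormalForm

lemma mem_center_iff_eq_or_eq_neg (A : SL2Z) : A ∈ Subgroup.center SL2Z ↔ A = 1 ∨ A = -1 := by
  rw [Matrix.SpecialLinearGroup.mem_center_iff]
  constructor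
  · rintro ⟨c, hc, h⟩
    rw [Fintype.card_fin, sq_eq_one_iff] at hc
    rcases hc with rfl | rfl
    · exact .inl (Subtype.ext (by simpa using h.symm))
    · exact .inr (Subtype.ext (by simpa using h.symm))
  · rintro (rfl | rfl)
    · exact ⟨1, by simp, by simp⟩
    · exact ⟨-1, by simp, by simp⟩

lemma coe_eq_coe_iff (A B : SL2Z) : (A : G) = (B : G) ↔ B = A ∨ B = -A := by
  rw [QuotientGroup.eq, mem_center_iff_eq_or_eq_neg, inv_mul_eq_one, inv_mul_eq_iff_eq_mul,
    mul_neg, mul_one, eq_comm]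

/-- The matrix representing `r`. -/
def matR : SL2Z := ⟨!![0, 1; -1, 0], by norm_num [Matrix.det_fin_two_of]⟩

/-- The matrix `[[1,n],[0,1]]`, representing `u ^ n`. -/
def shear (n : ℤ) : SL2Z := ⟨!![1, n; 0, 1], by norm_num [Matrix.det_fin_two_of]⟩

@[simp]
lemma coe_matR : (matR : Matrix (Fin 2) (Fin 2) ℤ) = !![0, 1; -1, 0] := rfl

@[simp]
lemma coe_shear (n : ℤ) : (shear n : Matrix (Fin 2) (Fin 2) ℤ) = !![1, n; 0, 1] := rfl

lemma r_eq : r = (matR : G) := rfl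

lemma u_eq : u = (shear 1 : G) := rfl

lemma u_inv_eq : u⁻¹ = (shear (-1) : G) := by
  rw [u_eq, ← QuotientGroup.mk_inv]
  congr 1
  ext i j
  fin_cases i <;> fin_cases j <;>
    simp [Matrix.SpecialLinearGroup.coe_inv, Matrix.adjugate_fin_two]

@[simp]
lemma r_mul_r : r * r = 1 := by
  rw [r_eq, ← QuotientGroup.mk_mul, ← QuotientGroup.mk_one, coe_eq_coe_iff]
  right
  ext i j
  fin_cases i <;> fin_cases j <;> simp

@[simp]
lemma r_inv : r⁻¹ = r := inv_eq_of_mul_eq_one_left r_mul_r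

@[simp]
lemma r_mul_r_mul (g : G) : r * (r * g) = g := by rw [← mul_assoc, r_mul_r, one_mul]

lemma u_mul_r_mul_u : u * r * u = r * u⁻¹ * r := by
  rw [u_inv_eq, u_eq, r_eq]
  simp only [← QuotientGroup.mk_mul]
  rw [coe_eq_coe_iff]
  left
  ext i j
  fin_cases i <;> fin_cases j <;> simp

@[simp]
lemma Letter.toG_inv (t : Letter) : t.inv.toG = t.toG⁻¹ := by
  rcases t with _ | _ | _ <;> simp [Letter.inv, Letter.toG]

@[simp]
lemma Letter.inv_inv (t : Letter) : t.inv.inv = t := by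
  rcases t with _ | _ | _ <;> rfl

lemma toG_not (a : Bool) : Letter.toG (some (!a)) = (Letter.toG (some a))⁻¹ :=
  Letter.toG_inv (some a)

lemma toG_mul_r_mul_toG (a : Bool) :
    Letter.toG (some a) * (r * Letter.toG (some a)) = r * ((Letter.toG (some a))⁻¹ * r) := by
  have h := u_mul_r_mul_u
  cases a
  · have h' := congrArg (fun g => g⁻¹) h
    simpa [Letter.toG, mul_assoc] using h'
  · simpa [Letter.toG, mul_assoc] using h

lemma toG_mul_r (a : Bool) :
    Letter.toG (some a) * r =
      r * ((Letter.toG (some a))⁻¹ * (r * (Letter.toG (some a))⁻¹)) := by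
  have h := congrArg (fun g => g * (Letter.toG (some a))⁻¹) (toG_mul_r_mul_toG a)
  simpa [mul_assoc] using h

namespace NormalForm

lemma eval_pop (e a : Bool) (l : List Bool) :
    (pop e a l).eval = evalCore e a l * (Letter.toG (some a))⁻¹ := by
  cases l
  · cases e <;> simp [pop, eval, evalCore, flag]
  · simp [pop, eval, evalCore]

lemma eval_flip (e a : Bool) (l : List Bool) :
    (flip e a l).eval = evalCore e a l * (r * Letter.toG (some a)) := by
  rcases l with _ | ⟨b, l⟩
  · cases e <;> simp [flip, eval, evalCore, flag, mul_assoc, toG_mul_r_mul_toG, toG_not]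
  · rcases Bool.eq_or_eq_not a b with rfl | rfl
    · simp [flip, eval, evalCore, flag, mul_assoc, toG_mul_r_mul_toG, toG_not]
    · simp [flip, eval, evalCore, flag, mul_assoc, toG_not, toG_mul_r]

@[simp]
lemma eval_act (x : NormalForm) (t : Letter) : (x.act t).eval = x.eval * t.toG := by
  rcases x with _ | _ | ⟨e, a, l, d⟩ <;> rcases t with _ | c
  · simp [act, eval, Letter.toG]
  · simp [act, eval, evalCore, flag]
  · simp [act, eval, Letter.toG]
  · simp [act, eval, evalCore, flag]
  · cases d <;> simp [act, eval, Letter.toG, flag, mul_assoc]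
  · rcases Bool.eq_or_eq_not c a with rfl | rfl <;> cases d
    · simp [act, eval, evalCore, flag]
    · rw [act, if_pos rfl, eval_flip, eval, flag, if_pos rfl, mul_assoc]
    · rw [act, if_neg (by simp), eval_pop, eval, flag, if_neg (by simp), mul_one, toG_not]
    · simp [act, eval, evalCore, flag]

@[simp]
lemma act_act_inv (x : NormalForm) (t : Letter) : (x.act t.inv).act t = x := by
  rcases x with _ | _ | ⟨e, a, _ | ⟨b, l⟩, d⟩ <;> rcases t with _ | c
  all_goals try cases e
  all_goals try cases a
  all_goals try cases b
  all_goals try cases c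
  all_goals try cases d
  all_goals rfl

lemma len_act_inv (x : NormalForm) (t : Letter) :
    (t ∈ x.lastLetters ∧ (x.act t.inv).len + 1 = x.len) ∨
      (t ∉ x.lastLetters ∧ (x.act t.inv).len = x.len + 1) := by
  rcases x with _ | _ | ⟨e, a, _ | ⟨b, l⟩, d⟩ <;> rcases t with _ | c
  all_goals try cases e
  all_goals try cases a
  all_goals try cases b
  all_goals try cases c
  all_goals try cases d
  all_goals simp [act, lastLetters, Letter.inv, len, lenCore, pop, flip, afterR]

lemma len_act_eq_iff (x : NormalForm) (t : Letter) :
    (x.act t).len = x.len + 1 ↔ t.inv ∉ x.lastLetters := by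
  have := x.len_act_inv t.inv
  rw [Letter.inv_inv] at this
  grind

lemma len_act_le (x : NormalForm) (t : Letter) : (x.act t).len ≤ x.len + 1 := by
  have := x.len_act_inv t.inv
  rw [Letter.inv_inv] at this
  omega

lemma eq_one_or_exists_lastLetter (x : NormalForm) : x = one ∨ ∃ t, t ∈ x.lastLetters := by
  rcases x with _ | _ | ⟨e, a, l, _ | _⟩
  · exact .inl rfl
  · exact .inr ⟨none, by simp [lastLetters]⟩
  · exact .inr ⟨some a, by simp [lastLetters]⟩
  · exact .inr ⟨none, by cases h : afterR e a l <;> simp [lastLetters, h]⟩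

lemma type_eq (x : NormalForm) : x.type =
    if x.suffixes = ∅ then 0
    else if x.suffixes = {[none]} then 1
    else if ∃ a, x.suffixes = {[some a, none]} then 2
    else if ∃ a, x.suffixes = {[some a]} ∨ x.suffixes = {[some a, some a]} then 3
    else if ∃ a, x.suffixes = {[none, some a]} ∨
      x.suffixes = {[none, some a], [some a, some a]} then 4
    else 5 := by
  rcases x with _ | _ | ⟨e, a, _ | ⟨b, _ | ⟨c, l⟩⟩, d⟩
  all_goals try cases e
  all_goals try cases a
  all_goals try cases b
  all_goals try cases c
  all_goals try cases d
  all_goals rfl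

lemma map_type_act (x : NormalForm) :
    ((Finset.univ.filter fun t : Letter => t.inv ∉ x.lastLetters).val.map
      fun t => (x.act t).type) = typeSucc x.type := by
  rcases x with _ | _ | ⟨e, a, _ | ⟨b, l⟩, d⟩
  all_goals try cases e
  all_goals try cases a
  all_goals try cases b
  all_goals try cases d
  all_goals exact of_decide_eq_true rfl

/-- `g` is represented by a matrix each of whose rows `(p, q)` satisfies `p² ≤ ± p q`, the sign
being given by `a`. -/
def Dominated (a : Bool) (g : G) : Prop :=
  ∃ A : SL2Z, (A : G) = g ∧ ∀ i, A i 0 ^ 2 ≤ (if a then 1 else -1) * (A i 0 * A i 1)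

lemma toG_some_eq (a : Bool) :
    Letter.toG (some a) = (shear (if a then 1 else -1) : G) := by
  cases a
  · exact u_inv_eq
  · rfl

lemma Dominated.mul {a : Bool} {g : G} (h : Dominated a g) :
    Dominated a (g * Letter.toG (some a)) := by
  obtain ⟨A, rfl, hA⟩ := h
  refine ⟨A * shear (if a then 1 else -1), ?_, fun i => ?_⟩
  · rw [QuotientGroup.mk_mul, toG_some_eq]
  · have := hA i
    cases a <;> simp [Matrix.mul_apply, Fin.sum_univ_two] at this ⊢ <;> nlinarith

lemma Dominated.mul_r_mul {a : Bool} {g : G} (h : Dominated a g) :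
    Dominated (!a) (g * r * Letter.toG (some (!a))) := by
  obtain ⟨A, rfl, hA⟩ := h
  refine ⟨A * matR * shear (if !a then 1 else -1), ?_, fun i => ?_⟩
  · rw [QuotientGroup.mk_mul, QuotientGroup.mk_mul, toG_some_eq, r_eq]
  · have := hA i
    cases a <;> simp [Matrix.mul_apply, Fin.sum_univ_two] at this ⊢ <;>
      nlinarith [sq_nonneg (A i 0)]

lemma dominated_flag_mul (e a : Bool) : Dominated a (flag e * Letter.toG (some a)) := by
  rw [toG_some_eq]
  cases e
  · refine ⟨shear (if a then 1 else -1), (one_mul _).symm, fun i => ?_⟩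
    cases a <;> fin_cases i <;> simp
  · refine ⟨matR * shear (if a then 1 else -1), ?_, fun i => ?_⟩
    · rw [QuotientGroup.mk_mul, flag, if_pos rfl, r_eq]
    · cases a <;> fin_cases i <;> simp

lemma dominated_evalCore (e a : Bool) (l : List Bool) : Dominated a (evalCore e a l) := by
  induction l generalizing a with
  | nil => exact dominated_flag_mul e a
  | cons b l ih =>
    rcases Bool.eq_or_eq_not a b with rfl | rfl
    · simpa [evalCore, flag] using (ih a).mul
    · simpa [evalCore, flag] using (ih b).mul_r_mul

lemma not_dominated_one (a : Bool) : ¬ Dominated a 1 := by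
  rintro ⟨A, h, hA⟩
  rw [← QuotientGroup.mk_one, eq_comm, coe_eq_coe_iff] at h
  have := hA 0
  rcases h with rfl | rfl <;> simp at this

lemma not_dominated_r (a : Bool) : ¬ Dominated a r := by
  rintro ⟨A, h, hA⟩
  rw [r_eq, eq_comm, coe_eq_coe_iff] at h
  have := hA 1
  rcases h with rfl | rfl <;> simp at this

lemma r_ne_one : r ≠ 1 := by
  rw [r_eq, ← QuotientGroup.mk_one, Ne, coe_eq_coe_iff]
  rintro (h | h) <;> simpa using congrArg (fun A : SL2Z => A 0 0) h

lemma eq_one_of_eval_eq_one {x : NormalForm} (h : x.eval = 1) : x = one := by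
  rcases x with _ | _ | ⟨e, a, l, _ | _⟩
  · rfl
  · exact absurd h r_ne_one
  · have := dominated_evalCore e a l
    simp only [eval, flag, Bool.false_eq_true, if_false, mul_one] at h
    exact absurd (h ▸ this) (not_dominated_one a)
  · have := dominated_evalCore e a l
    simp only [eval, flag, if_true] at h
    rw [mul_eq_one_iff_eq_inv, r_inv] at h
    exact absurd (h ▸ this) (not_dominated_r a)

lemma eval_injective : Function.Injective eval := by
  intro x y h
  induction hn : x.len using Nat.strong_induction_on generalizing x y with
  | _ n ih =>
    rcases x.eq_one_or_exists_lastLetter with rfl | ⟨t, ht⟩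
    · exact (eq_one_of_eval_eq_one h.symm).symm
    · have hlt : (x.act t.inv).len < n := by
        have := x.len_act_inv t
        grind
      have := ih _ hlt (x := x.act t.inv) (y := y.act t.inv) (by simp [h]) rfl
      rw [← act_act_inv x t, this, act_act_inv]

lemma eval_surjective : Function.Surjective eval := by
  intro g
  induction g using QuotientGroup.induction_on with
  | H A =>
    have hS : (ModularGroup.S : G) = Letter.toG none := by
      rw [Letter.toG, r_eq, coe_eq_coe_iff]
      right
      ext i j
      fin_cases i <;> fin_cases j <;> simp [ModularGroup.coe_S]
    have hT : (ModularGroup.T : G) = Letter.toG (some true) := rfl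
    have hA : A ∈ Subgroup.closure {ModularGroup.S, ModularGroup.T} := by
      rw [SpecialLinearGroup.SL2Z_generators]
      trivial
    induction hA using Subgroup.closure_induction_right with
    | one => exact ⟨one, rfl⟩
    | mul_right A _ B hB ih =>
      obtain ⟨x, hx⟩ := ih
      rcases hB with rfl | rfl
      · exact ⟨x.act none, by rw [eval_act, hx, QuotientGroup.mk_mul, hS]⟩
      · exact ⟨x.act (some true), by rw [eval_act, hx, QuotientGroup.mk_mul, hT]⟩
    | mul_inv_cancel A _ B hB ih =>
      obtain ⟨x, hx⟩ := ih
      rcases hB with rfl | rfl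
      · exact ⟨x.act (Letter.inv none),
          by rw [eval_act, hx, QuotientGroup.mk_mul, QuotientGroup.mk_inv, hS, Letter.toG_inv]⟩
      · exact ⟨x.act (Letter.inv (some true)),
          by rw [eval_act, hx, QuotientGroup.mk_mul, QuotientGroup.mk_inv, hT, Letter.toG_inv]⟩

end NormalForm

lemma Letter.toG_injective : Function.Injective Letter.toG := by
  intro s t h
  have h' := eval_injective (a₁ := one.act s) (a₂ := one.act t) (by simp [h])
  rcases s with _ | _ | _ <;> rcases t with _ | _ | _ <;> first | rfl | cases h'

lemma mem_S_iff (g : G) : g ∈ S ↔ ∃ t : Letter, t.toG = g := by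
  constructor
  · rintro (rfl | rfl | rfl)
    exacts [⟨none, rfl⟩, ⟨some true, rfl⟩, ⟨some false, rfl⟩]
  · rintro ⟨_ | _ | _, rfl⟩ <;> simp [S, Letter.toG]

lemma isWord_append_singleton (w : List G) (g : G) :
    IsWord (w ++ [g]) ↔ IsWord w ∧ g ∈ S := by
  simp only [IsWord, List.mem_append, List.mem_singleton]
  grind

namespace NormalForm

lemma exists_word (x : NormalForm) : ∃ w, IsWord w ∧ w.prod = x.eval ∧ w.length = x.len := by
  induction hn : x.len using Nat.strong_induction_on generalizing x with
  | _ n ih =>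
    rcases x.eq_one_or_exists_lastLetter with rfl | ⟨t, ht⟩
    · exact ⟨[], by simp [IsWord], rfl, hn⟩
    · have hlen : (x.act t.inv).len + 1 = n := by
        have := x.len_act_inv t
        grind
      obtain ⟨w, hw, hp, hl⟩ := ih _ (by omega) (x.act t.inv) rfl
      exact ⟨w ++ [t.toG], (isWord_append_singleton _ _).2 ⟨hw, (mem_S_iff _).2 ⟨t, rfl⟩⟩,
        by simp [hp], by simp [hl, hlen]⟩

lemma len_le_length {w : List G} (hw : IsWord w) {x : NormalForm} (hx : w.prod = x.eval) :
    x.len ≤ w.length := by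
  induction w using List.reverseRecOn generalizing x with
  | nil => simp [eq_one_of_eval_eq_one hx.symm, len]
  | append_singleton w g ih =>
    obtain ⟨hw', hg⟩ := (isWord_append_singleton _ _).1 hw
    obtain ⟨t, rfl⟩ := (mem_S_iff _).1 hg
    have h₁ := ih hw' (x := x.act t.inv) (by simp [← hx])
    have h₂ := len_act_le (x.act t.inv) t
    rw [act_act_inv] at h₂
    simp
    omega

lemma wordNorm_eval (x : NormalForm) : wordNorm x.eval = x.len := by
  refine IsLeast.csInf_eq ⟨exists_word x, ?_⟩
  rintro _ ⟨w, hw, hx, rfl⟩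
  exact len_le_length hw hx

lemma exists_isGeodesic (x : NormalForm) : ∃ w, IsGeodesic x.eval w := by
  simpa only [IsGeodesic, wordNorm_eval] using x.exists_word

lemma isGeodesic_append_singleton (x : NormalForm) (w : List G) (t : Letter) :
    IsGeodesic x.eval (w ++ [t.toG]) ↔
      t ∈ x.lastLetters ∧ IsGeodesic (x.act t.inv).eval w := by
  simp only [IsGeodesic, wordNorm_eval, isWord_append_singleton, mem_S_iff, List.prod_append,
    List.prod_singleton, List.length_append, List.length_singleton]
  rw [eval_act, Letter.toG_inv, eq_mul_inv_iff_mul_eq]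
  have h := x.len_act_inv t
  constructor
  · rintro ⟨⟨hw, -⟩, hp, hl⟩
    have := len_le_length hw (x := x.act t.inv) (by simp [← hp])
    refine ⟨?_, hw, hp, ?_⟩ <;> grind
  · rintro ⟨ht, hw, hp, hl⟩
    exact ⟨⟨hw, t, rfl⟩, hp, by grind⟩

lemma suf_one_eval (x : NormalForm) :
    Suf 1 x.eval = List.map Letter.toG '' (x.lastLetters.image fun t => [t] : Finset _) := by
  ext v
  simp only [Suf, Set.mem_ofPred_eq, Finset.coe_image, Set.mem_image, Finset.mem_coe]
  constructor
  · rintro ⟨hv, _, hw, w, rfl⟩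
    obtain ⟨g, rfl⟩ := List.length_eq_one_iff.1 hv
    obtain ⟨t, rfl⟩ := (mem_S_iff _).1 ((isWord_append_singleton _ _).1 hw.1).2
    exact ⟨[t], ⟨t, ((isGeodesic_append_singleton x w t).1 hw).1, rfl⟩, rfl⟩
  · rintro ⟨_, ⟨t, ht, rfl⟩, rfl⟩
    obtain ⟨w, hw⟩ := (x.act t.inv).exists_isGeodesic
    exact ⟨rfl, w ++ [t.toG], (isGeodesic_append_singleton x w t).2 ⟨ht, hw⟩, w, rfl⟩

lemma suf_two_eval (x : NormalForm) :
    Suf 2 x.eval = List.map Letter.toG '' (x.suffixes₂ : Set (List Letter)) := by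
  ext v
  simp only [Suf, suffixes₂, Set.mem_ofPred_eq, Finset.coe_biUnion, Finset.coe_image,
    Set.mem_image, Set.mem_iUnion, Finset.mem_coe, exists_prop]
  constructor
  · rintro ⟨hv, _, hw, w, rfl⟩
    obtain ⟨g, g', rfl⟩ := List.length_eq_two.1 hv
    rw [List.append_cons] at hw
    have hword := (isWord_append_singleton _ _).1 hw.1
    obtain ⟨t, rfl⟩ := (mem_S_iff _).1 hword.2
    obtain ⟨s, rfl⟩ := (mem_S_iff _).1 ((isWord_append_singleton _ _).1 hword.1).2
    obtain ⟨ht, hw⟩ := (isGeodesic_append_singleton x _ t).1 hw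
    exact ⟨[s, t], ⟨t, ht, s, ((isGeodesic_append_singleton _ w s).1 hw).1, rfl⟩, rfl⟩
  · rintro ⟨_, ⟨t, ht, s, hs, rfl⟩, rfl⟩
    obtain ⟨w, hw⟩ := ((x.act t.inv).act s.inv).exists_isGeodesic
    have hw := (isGeodesic_append_singleton _ w s).2 ⟨hs, hw⟩
    exact ⟨rfl, w ++ [s.toG] ++ [t.toG], (isGeodesic_append_singleton x _ t).2 ⟨ht, hw⟩,
      w, by simp⟩

lemma suf2Star_eval (x : NormalForm) :
    Suf2Star x.eval = List.map Letter.toG '' (x.suffixes : Set (List Letter)) := by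
  rw [Suf2Star, suf_one_eval, suf_two_eval, suffixes]
  by_cases h : x.suffixes₂ = ∅
  · simp [h]
  · rw [if_neg h, if_pos]
    simpa [Finset.nonempty_iff_ne_empty] using h

lemma suf2Star_eval_eq_iff (x : NormalForm) (s : Finset (List Letter)) :
    Suf2Star x.eval = List.map Letter.toG '' (s : Set (List Letter)) ↔ x.suffixes = s := by
  rw [suf2Star_eval, (Letter.toG_injective.list_map.image_injective).eq_iff, Finset.coe_inj]

lemma exists_mem_u_iff (p : G → Prop) :
    (∃ a ∈ ({u, u⁻¹} : Set G), p a) ↔ ∃ a : Bool, p (Letter.toG (some a)) := by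
  simp [Letter.toG, or_comm]

lemma T_eval (x : NormalForm) : T x.eval = x.type := by
  have h := x.suf2Star_eval_eq_iff
  have h₀ := h ∅
  have h₁ := h {[none]}
  have h₂ (a : Bool) := h {[some a, none]}
  have h₃ (a : Bool) := h {[some a]}
  have h₃' (a : Bool) := h {[some a, some a]}
  have h₄ (a : Bool) := h {[none, some a]}
  have h₄' (a : Bool) := h {[none, some a], [some a, some a]}
  have hr : Letter.toG none = r := rfl
  simp only [Finset.coe_empty, Finset.coe_singleton, Finset.coe_insert, Set.image_empty,
    Set.image_singleton, Set.image_insert_eq, List.map_cons, List.map_nil, hr]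
    at h₀ h₁ h₂ h₃ h₃' h₄ h₄'
  simp only [T, exists_mem_u_iff, h₀, h₁, h₂, h₃, h₃', h₄, h₄', type_eq x]

lemma splusF_eval (x : NormalForm) :
    SplusF x.eval = (Finset.univ.filter fun t : Letter => t.inv ∉ x.lastLetters).map
      ⟨Letter.toG, Letter.toG_injective⟩ := by
  ext g
  have hS : (g = r ∨ g = u ∨ g = u⁻¹) ↔ ∃ t : Letter, t.toG = g := mem_S_iff g
  simp only [SplusF, Finset.mem_filter, Finset.mem_insert, Finset.mem_singleton, hS, Finset.mem_map, Finset.mem_univ, true_and,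
    Function.Embedding.coeFn_mk]
  constructor
  · rintro ⟨⟨t, rfl⟩, h⟩
    rw [← eval_act, wordNorm_eval, wordNorm_eval, len_act_eq_iff] at h
    exact ⟨t, h, rfl⟩
  · rintro ⟨t, h, rfl⟩
    rw [← eval_act, wordNorm_eval, wordNorm_eval, len_act_eq_iff]
    exact ⟨⟨t, rfl⟩, h⟩

end NormalForm

lemma map_T_splusF (g : G) : (SplusF g).val.map (fun s => T (g * s)) = typeSucc (T g) := by
  obtain ⟨x, rfl⟩ := eval_surjective g
  rw [splusF_eval, T_eval, ← map_type_act, Finset.map_val, Multiset.map_map]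
  exact Multiset.map_congr rfl fun t _ => by
    rw [Function.comp_apply, ← T_eval, eval_act]
    rfl

lemma typeSucc_injective : Function.Injective typeSucc := by
  unfold Function.Injective
  decide

/-- `T` is compatible with `S`, and, moreover, the multiset of types of successors
of `g` is `{1,3,3}`, `{4,4}`, `{4,5}`, `{2,3}`, `{3,5}`, `{4}` according to whether
`T g = 0, 1, 2, 3, 4, 5`. -/
theorem T_compatible_and_successors :
    (∀ g g' : G, T g = T g' ↔
      (SplusF g).val.map (fun s => T (g * s)) =
        (SplusF g').val.map (fun s => T (g' * s))) ∧
    ∀ g : G, (SplusF g).val.map (fun s => T (g * s)) = typeSucc (T g) := by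
  refine ⟨fun g g' => ?_, map_T_splusF⟩
  rw [map_T_splusF, map_T_splusF, typeSucc_injective.eq_iff]

end PSL2Z
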